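/- arXiv:1907.03531 — 4 statements merged into one kernel-verified Lean document; each statement's English description precedes it below -/
import Mathlib

section
/- Let (H, blocks, ε, π_1, π_2, π_3) be a connected CTKT stranded graph, and let V_t, V_p, V_d denote its numbers of tetrahedral, pillow and double-trace vertices, and F its total number of faces. Then 2·F ≤ 6 + 3·V_t + 4·V_p + 6·V_d; in other words, the CTKT degree ω := 3 + (3/2)·V_t + 2·V_p + 3·V_d − F is non-negative. -/
open Module

/-- The functions on `H`, with values in the field with two elements, that are invariant
under the permutation `σ`. -/
def invariantFunctions {H : Type} (σ : Equiv.Perm H) : Submodule (ZMod 2) (H → ZMod 2) where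
  carrier := {f | ∀ h, f (σ h) = f h}
  add_mem' hf hg h := by simp [hf h, hg h]
  zero_mem' _ := rfl
  smul_mem' c f hf h := by simp [hf h]

theorem mem_invariantFunctions {H : Type} {σ : Equiv.Perm H} {f : H → ZMod 2} :
    f ∈ invariantFunctions σ ↔ ∀ h, f (σ h) = f h := Iff.rfl

theorem card_orbits_le_finrank {H : Type} [Fintype H] (σ τ : Equiv.Perm H) :
    Nat.card (MulAction.orbitRel.Quotient (Subgroup.closure {σ, τ} : Subgroup (Equiv.Perm H)) H)
      ≤ finrank (ZMod 2) ↥(invariantFunctions σ ⊓ invariantFunctions τ) := by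
  classical
  set G : Subgroup (Equiv.Perm H) := Subgroup.closure {σ, τ}
  let q : H → MulAction.orbitRel.Quotient G H := Quotient.mk''
  have hq : Function.Surjective q := Quotient.mk''_surjective
  have : Finite (MulAction.orbitRel.Quotient G H) := Finite.of_surjective q hq
  have := Fintype.ofFinite (MulAction.orbitRel.Quotient G H)
  have hinv : ∀ g ∈ G, ∀ h, q (g h) = q h := fun g hg h =>
    Quotient.sound' ⟨⟨g, hg⟩, rfl⟩
  have hinj := LinearMap.funLeft_injective_of_surjective (ZMod 2) (ZMod 2) q hq
  have hle : LinearMap.range (LinearMap.funLeft (ZMod 2) (ZMod 2) q) ≤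
      invariantFunctions σ ⊓ invariantFunctions τ := by
    rintro _ ⟨u, rfl⟩
    refine ⟨fun h => ?_, fun h => ?_⟩
    · exact congrArg u (hinv σ (Subgroup.subset_closure (by simp)) h)
    · exact congrArg u (hinv τ (Subgroup.subset_closure (by simp)) h)
  calc _ = finrank (ZMod 2) (MulAction.orbitRel.Quotient G H → ZMod 2) := by simp
    _ = finrank (ZMod 2) ↥(LinearMap.range (LinearMap.funLeft (ZMod 2) (ZMod 2) q)) :=
      (LinearMap.finrank_range_of_inj hinj).symm
    _ ≤ _ := Submodule.finrank_mono hle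

theorem dotProduct_eq_zero_of_invariant {H : Type} [Fintype H] {σ : Equiv.Perm H}
    (hσ : σ * σ = 1) (hσ' : ∀ h, σ h ≠ h) {f g : H → ZMod 2}
    (hf : f ∈ invariantFunctions σ) (hg : g ∈ invariantFunctions σ) : f ⬝ᵥ g = 0 := by
  refine Finset.sum_involution (fun h _ => σ h) (fun h _ => ?_) (fun h _ _ => hσ' h)
    (fun _ _ => Finset.mem_univ _) (fun h _ => ?_)
  · rw [hf h, hg h]
    exact CharTwo.add_self_eq_zero _
  · exact congrArg (fun ρ : Equiv.Perm H => ρ h) hσ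

theorem two_mul_finrank_le_of_isotropic {K H : Type} [Field K] [Fintype H]
    (S : Submodule K (H → K)) (hS : ∀ f ∈ S, ∀ g ∈ S, f ⬝ᵥ g = 0) :
    2 * finrank K S ≤ Fintype.card H := by
  classical
  have hle : S.map (dotProductEquiv K H).toLinearMap ≤ S.dualAnnihilator := by
    rintro _ ⟨f, hf, rfl⟩
    rw [Submodule.mem_dualAnnihilator]
    intro g hg
    exact hS f hf g hg
  have h1 := Submodule.finrank_mono hle
  rw [LinearEquiv.finrank_map_eq] at h1
  have h2 := Subspace.finrank_add_finrank_dualAnnihilator_eq S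
  rw [finrank_fintype_fun_eq_card] at h2
  omega

theorem finrank_add_le_of_isotropic {K H : Type} [Field K] [Fintype H]
    (X Y Z : Submodule K (H → K))
    (hX : ∀ f ∈ X, ∀ g ∈ X, f ⬝ᵥ g = 0) (hY : ∀ f ∈ Y, ∀ g ∈ Y, f ⬝ᵥ g = 0)
    (hZ : ∀ f ∈ Z, ∀ g ∈ Z, f ⬝ᵥ g = 0) :
    2 * (finrank K ↥(X ⊓ Y) + finrank K ↥(X ⊓ Z) + finrank K ↥(Y ⊓ Z)) ≤
      Fintype.card H + 4 * finrank K ↥(X ⊓ (Y ⊓ Z)) := by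
  have h1 := Submodule.finrank_sup_add_finrank_inf_eq (X ⊓ Y) (X ⊓ Z)
  have h2 := Submodule.finrank_sup_add_finrank_inf_eq ((X ⊓ Y) ⊔ (X ⊓ Z)) (Y ⊓ Z)
  have h3 : finrank K ↥((X ⊓ Y) ⊓ (X ⊓ Z)) = finrank K ↥(X ⊓ (Y ⊓ Z)) := by
    rw [← inf_inf_distrib_left]
  have h4 : finrank K ↥(((X ⊓ Y) ⊔ (X ⊓ Z)) ⊓ (Y ⊓ Z)) ≤ finrank K ↥(X ⊓ (Y ⊓ Z)) :=
    Submodule.finrank_mono (inf_le_inf_right _ (sup_le inf_le_left inf_le_left))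
  have h5 := two_mul_finrank_le_of_isotropic (((X ⊓ Y) ⊔ (X ⊓ Z)) ⊔ (Y ⊓ Z)) (by
    intro f hf g hg
    obtain ⟨f', hf', f₃, hf₃, rfl⟩ := Submodule.mem_sup.1 hf
    obtain ⟨f₁, hf₁, f₂, hf₂, rfl⟩ := Submodule.mem_sup.1 hf'
    obtain ⟨g', hg', g₃, hg₃, rfl⟩ := Submodule.mem_sup.1 hg
    obtain ⟨g₁, hg₁, g₂, hg₂, rfl⟩ := Submodule.mem_sup.1 hg'
    simp only [add_dotProduct, dotProduct_add]
    rw [hX f₁ hf₁.1 g₁ hg₁.1, hX f₁ hf₁.1 g₂ hg₂.1, hY f₁ hf₁.2 g₃ hg₃.1,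
      hX f₂ hf₂.1 g₁ hg₁.1, hX f₂ hf₂.1 g₂ hg₂.1, hZ f₂ hf₂.2 g₃ hg₃.2,
      hY f₃ hf₃.1 g₁ hg₁.2, hZ f₃ hf₃.2 g₂ hg₂.2, hY f₃ hf₃.1 g₃ hg₃.1]
    simp)
  omega

theorem eq_of_mem_fiber_of_card_eq_four {H B : Type} [Fintype H] {blk : H → B} {b : B}
    (hb : Nat.card {h : H // blk h = b} = 4) {p q r s h : H}
    (hp : blk p = b) (hq : blk q = b) (hr : blk r = b) (hs : blk s = b) (hh : blk h = b)
    (hpq : p ≠ q) (hpr : p ≠ r) (hps : p ≠ s) (hqr : q ≠ r) (hqs : q ≠ s) (hrs : r ≠ s) :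
    h = p ∨ h = q ∨ h = r ∨ h = s := by
  classical
  have hcard : (Finset.univ.filter fun h => blk h = b).card = 4 := by
    rw [← hb, Nat.card_eq_fintype_card, Fintype.card_subtype]
  have heq : ({p, q, r, s} : Finset H) = Finset.univ.filter fun h => blk h = b := by
    apply Finset.eq_of_subset_of_card_le
    · intro x hx
      simp only [Finset.mem_insert, Finset.mem_singleton] at hx
      rcases hx with rfl | rfl | rfl | rfl <;> simpa
    · rw [hcard, Finset.card_insert_of_notMem, Finset.card_insert_of_notMem,
        Finset.card_insert_of_notMem, Finset.card_singleton] <;> simp [*]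
  have : h ∈ ({p, q, r, s} : Finset H) := by rw [heq]; simpa
  simpa using this

theorem finrank_invariant_pair_le {H B : Type} [Fintype H] [Fintype B] {blk : H → B}
    (hblk : ∀ b, Nat.card {h : H // blk h = b} = 4) {α β : Equiv.Perm H}
    (hα : α * α = 1) (hα' : ∀ h, α h ≠ h) (hαb : ∀ h, blk (α h) = blk h)
    (hβ' : ∀ h, β h ≠ h) (hβb : ∀ h, blk (β h) = blk h) :
    finrank (ZMod 2) ↥(invariantFunctions α ⊓ invariantFunctions β) ≤
      Fintype.card B + Nat.card {b : B // ∀ h, blk h = b → α h = β h} := by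
  classical
  have hαα : ∀ h, α (α h) = h := fun h => congrArg (fun ρ : Equiv.Perm H => ρ h) hα
  have hex : ∀ b, ∃ x y, blk x = b ∧ blk y = b ∧ y ≠ x ∧ y ≠ α x := by
    intro b
    have hcard : (Finset.univ.filter fun h => blk h = b).card = 4 := by
      rw [← hblk b, Nat.card_eq_fintype_card, Fintype.card_subtype]
    obtain ⟨x, hx⟩ := Finset.card_pos.1
      (by omega : 0 < (Finset.univ.filter fun h => blk h = b).card)
    obtain ⟨y, hy, hy'⟩ := Finset.exists_mem_notMem_of_card_lt_card
      (s := {x, α x}) (t := Finset.univ.filter fun h => blk h = b)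
      (lt_of_le_of_lt Finset.card_le_two (by omega))
    exact ⟨x, y, by simpa using hx, by simpa using hy, by simp_all, by simp_all⟩
  choose x y hx hy hyx hyαx using hex
  let P : B → Prop := fun b => ∀ h, blk h = b → α h = β h
  let e : B ⊕ {b // P b} → H := Sum.elim x (fun b => y b)
  let T := (LinearMap.funLeft (ZMod 2) (ZMod 2) e).domRestrict
    (invariantFunctions α ⊓ invariantFunctions β)
  have hT : Function.Injective T := by
    rw [injective_iff_map_eq_zero]
    rintro ⟨f, hfα, hfβ⟩ hf
    rw [SetLike.mem_coe, mem_invariantFunctions] at hfα hfβ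
    have hf₁ : ∀ b, f (x b) = 0 := fun b => congrFun hf (Sum.inl b)
    have hf₂ : ∀ b, P b → f (y b) = 0 := fun b hb => congrFun hf (Sum.inr ⟨b, hb⟩)
    ext h
    change f h = 0
    by_cases hP : P (blk h)
    · have hyα : α (y (blk h)) ≠ x (blk h) := fun hc => hyαx _ (by rw [← hc, hαα])
      rcases eq_of_mem_fiber_of_card_eq_four (hblk (blk h)) (hx _) ((hαb _).trans (hx _))
        (hy _) ((hαb _).trans (hy _)) rfl (hα' _).symm (hyx _).symm hyα.symm (hyαx _).symm
        (fun hc => hyx _ (α.injective hc).symm) (hα' _).symm with h1 | h1 | h1 | h1 <;>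
      rw [h1] <;> simp only [hfα, hf₁, hf₂ _ hP]
    · obtain ⟨z, hz, hne⟩ : ∃ z, blk z = blk h ∧ α z ≠ β z := by
        simpa [P] using hP
      have hconst : ∀ w, blk w = blk h → f w = f z := by
        intro w hw
        rcases eq_of_mem_fiber_of_card_eq_four (hblk (blk h)) hz ((hαb _).trans hz)
          ((hβb _).trans hz) ((hαb _).trans ((hβb _).trans hz)) hw (hα' _).symm (hβ' _).symm
          (fun hc => hne (by rw [hc, hαα, ← hc])) hne (fun hc => hβ' _ (α.injective hc).symm)
          (hα' _).symm with h1 | h1 | h1 | h1 <;>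
        rw [h1] <;> simp only [hfα, hfβ]
      rw [hconst h rfl, ← hconst _ (hx (blk h)), hf₁]
  have := LinearMap.finrank_le_finrank_of_injective hT
  rwa [finrank_fintype_fun_eq_card, Fintype.card_sum, ← Nat.card_eq_fintype_card (α := {b // P b})]
    at this

theorem finrank_le_one_of_connected {H B : Type} [Fintype H] [Nonempty H] {blk : H → B}
    {ε : Equiv.Perm H} {π : Fin 3 → Equiv.Perm H} (hπblk : ∀ c h, blk (π c h) = blk h)
    (hconn : MulAction.IsPretransitive
      (Subgroup.closure ({ε} ∪ Set.range π) : Subgroup (Equiv.Perm H)) H) :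
    finrank (ZMod 2) ↥(invariantFunctions ε ⊓
      LinearMap.range (LinearMap.funLeft (ZMod 2) (ZMod 2) blk)) ≤ 1 := by
  refine (Submodule.finrank_mono (t := Submodule.span (ZMod 2) {fun _ : H => (1 : ZMod 2)})
    ?_).trans ((finrank_span_le_card _).trans (by simp))
  rintro _ ⟨hε, u, rfl⟩
  set f := LinearMap.funLeft (ZMod 2) (ZMod 2) blk u
  have hinv : ∀ g ∈ Subgroup.closure ({ε} ∪ Set.range π), ∀ h, f (g h) = f h := by
    intro g hg
    induction hg using Subgroup.closure_induction with
    | mem g hg =>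
      rcases hg with rfl | ⟨c, rfl⟩
      · exact hε
      · exact fun h => congrArg u (hπblk c h)
    | one => exact fun _ => rfl
    | mul g k _ _ ihg ihk => exact fun h => (ihg (k h)).trans (ihk h)
    | inv g _ ih => exact fun h =>
        (ih (g⁻¹ h)).symm.trans (congrArg f (g.apply_symm_apply h))
  obtain ⟨h₀⟩ := ‹Nonempty H›
  refine Submodule.mem_span_singleton.2 ⟨f h₀, ?_⟩
  ext h
  obtain ⟨⟨g, hg⟩, rfl⟩ := hconn.exists_smul_eq h₀ h
  exact (mul_one _).trans (hinv g hg h₀).symm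

theorem card_eq_four_mul_of_fibers {H B : Type} [Fintype H] [Fintype B] {blk : H → B}
    (hblk : ∀ b, Nat.card {h : H // blk h = b} = 4) : Fintype.card H = 4 * Fintype.card B := by
  classical
  rw [Fintype.card_congr (Equiv.sigmaFiberEquiv blk).symm, Fintype.card_sigma]
  simp_rw [← Nat.card_eq_fintype_card, hblk]
  simp [mul_comm]

/-- Euler's inequality for the faces of two colors. -/
theorem card_faces_pair_le {H B : Type} [Fintype H] [Nonempty H] [Fintype B] {blk : H → B}
    (hblk : ∀ b, Nat.card {h : H // blk h = b} = 4)
    {ε : Equiv.Perm H} (hε : ε * ε = 1) (hε' : ∀ h, ε h ≠ h)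
    {π : Fin 3 → Equiv.Perm H}
    (hπinv : ∀ c, π c * π c = 1) (hπfpf : ∀ c h, π c h ≠ h)
    (hπblk : ∀ c h, blk (π c h) = blk h)
    (hconn : MulAction.IsPretransitive
      (Subgroup.closure ({ε} ∪ Set.range π) : Subgroup (Equiv.Perm H)) H) (c c' : Fin 3) :
    Nat.card (MulAction.orbitRel.Quotient
        (Subgroup.closure {ε, π c} : Subgroup (Equiv.Perm H)) H) +
      Nat.card (MulAction.orbitRel.Quotient
        (Subgroup.closure {ε, π c'} : Subgroup (Equiv.Perm H)) H) ≤
      2 + Fintype.card B + Nat.card {b : B // ∀ h, blk h = b → π c h = π c' h} := by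
  have h1 := card_orbits_le_finrank ε (π c)
  have h2 := card_orbits_le_finrank ε (π c')
  have h3 := finrank_invariant_pair_le hblk (hπinv c) (hπfpf c) (hπblk c)
    (hπfpf c') (hπblk c')
  have h4 := finrank_add_le_of_isotropic (invariantFunctions ε) (invariantFunctions (π c))
    (invariantFunctions (π c'))
    (fun _ hf _ hg => dotProduct_eq_zero_of_invariant hε hε' hf hg)
    (fun _ hf _ hg => dotProduct_eq_zero_of_invariant (hπinv c) (hπfpf c) hf hg)
    (fun _ hf _ hg => dotProduct_eq_zero_of_invariant (hπinv c') (hπfpf c') hf hg)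
  have h5 := card_eq_four_mul_of_fibers hblk
  have h6 := finrank_le_one_of_connected hπblk hconn
  set X := invariantFunctions ε
  set W := invariantFunctions (π c) ⊓ invariantFunctions (π c')
  set D := LinearMap.range (LinearMap.funLeft (ZMod 2) (ZMod 2) blk)
  have hsurj : Function.Surjective blk := fun b => by
    have : Nonempty {h : H // blk h = b} :=
      (Nat.card_pos_iff.1 (by rw [hblk b]; norm_num)).1
    obtain ⟨h, hh⟩ := this
    exact ⟨h, hh⟩
  have hD : finrank (ZMod 2) D = Fintype.card B := by
    rw [LinearMap.finrank_range_of_inj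
      (LinearMap.funLeft_injective_of_surjective (ZMod 2) (ZMod 2) blk hsurj),
      finrank_fintype_fun_eq_card]
  have hDW : D ≤ W := by
    rintro _ ⟨u, rfl⟩
    exact ⟨fun h => congrArg u (hπblk c h), fun h => congrArg u (hπblk c' h)⟩
  have h7 := Submodule.finrank_sup_add_finrank_inf_eq (X ⊓ W) D
  have h8 : finrank (ZMod 2) ↥(X ⊓ W ⊔ D) ≤ finrank (ZMod 2) W :=
    Submodule.finrank_mono (sup_le inf_le_right hDW)
  have h9 : finrank (ZMod 2) ↥(X ⊓ W ⊓ D) ≤ finrank (ZMod 2) ↥(X ⊓ D) :=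
    Submodule.finrank_mono (inf_le_inf_right _ inf_le_left)
  omega

theorem card_vertex_types {B : Type} [Fintype B] (agree : B → Fin 3 → Fin 3 → Prop)
    (hrefl : ∀ b c, agree b c c) (hsymm : ∀ b c c', agree b c c' → agree b c' c)
    (htrans : ∀ b c c' c'', agree b c c' → agree b c' c'' → agree b c c'') :
    3 * Fintype.card B + (Nat.card {b // agree b 0 1} + Nat.card {b // agree b 0 2} +
        Nat.card {b // agree b 1 2}) =
      3 * Nat.card {b : B // ∀ c c', c ≠ c' → ¬ agree b c c'} +
      4 * Nat.card {b : B // (∃ c c', c ≠ c' ∧ agree b c c') ∧ ¬ (∀ c c', agree b c c')} +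
      6 * Nat.card {b : B // ∀ c c', agree b c c'} := by
  classical
  have hcard : ∀ p : B → Prop, Nat.card {b // p b} = ∑ b, if p b then 1 else 0 := fun p => by
    rw [Nat.card_eq_fintype_card, Fintype.card_subtype, Finset.card_filter]
  rw [← Finset.card_univ, Finset.card_eq_sum_ones]
  simp only [hcard, Finset.mul_sum, ← Finset.sum_add_distrib]
  refine Finset.sum_congr rfl fun b _ => ?_
  have h01 : agree b 1 0 ↔ agree b 0 1 := ⟨hsymm b 1 0, hsymm b 0 1⟩
  have h02 : agree b 2 0 ↔ agree b 0 2 := ⟨hsymm b 2 0, hsymm b 0 2⟩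
  have h12 : agree b 2 1 ↔ agree b 1 2 := ⟨hsymm b 2 1, hsymm b 1 2⟩
  have t1 := htrans b 0 1 2
  have t2 := htrans b 1 0 2
  have t3 := htrans b 0 2 1
  simp only [Fin.forall_fin_succ, Fin.exists_fin_succ, hrefl]
  clear hcard hrefl hsymm htrans
  by_cases p : agree b 0 1 <;> by_cases q : agree b 0 2 <;> by_cases r : agree b 1 2 <;>
    simp_all

/-- **Non-negativity of the CTKT degree.**  A CTKT stranded graph is a finite type `H` of
half-edges partitioned into 4-element blocks (the vertices, indexed by `B` via `blk`),
with a fixed-point-free involution `ε` (the edge pairing) and, for each color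
`c ∈ {1,2,3}`, a fixed-point-free block-preserving involution `π c`.  A block is
tetrahedral if the three induced pairings of the block are pairwise distinct, a pillow
if exactly two of them coincide, and double-trace if all three coincide.  The faces of
color `c` are the orbits of the subgroup generated by `ε` and `π c`, and `F` is the total
number of faces.  If the graph is connected, then `2·F ≤ 6 + 3·V_t + 4·V_p + 6·V_d`,
i.e. the CTKT degree `ω = 3 + (3/2)·V_t + 2·V_p + 3·V_d - F` is non-negative. -/
theorem ctkt_degree_nonneg
    (H : Type) [Fintype H] [Nonempty H]
    (B : Type) [Fintype B] (blk : H → B)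
    (hblk : ∀ b, Nat.card {h : H // blk h = b} = 4)
    (ε : Equiv.Perm H) (hε : ε * ε = 1) (hε' : ∀ h, ε h ≠ h)
    (π : Fin 3 → Equiv.Perm H)
    (hπinv : ∀ c, π c * π c = 1) (hπfpf : ∀ c h, π c h ≠ h)
    (hπblk : ∀ c h, blk (π c h) = blk h)
    (hconn : MulAction.IsPretransitive
      (Subgroup.closure ({ε} ∪ Set.range π) : Subgroup (Equiv.Perm H)) H)
    (agree : B → Fin 3 → Fin 3 → Prop)
    (hagree : ∀ b c c', agree b c c' ↔ ∀ h, blk h = b → π c h = π c' h)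
    (Vt Vp Vd F : ℕ)
    (hVt : Vt = Nat.card {b : B // ∀ c c', c ≠ c' → ¬ agree b c c'})
    (hVp : Vp = Nat.card {b : B //
        (∃ c c', c ≠ c' ∧ agree b c c') ∧ ¬ (∀ c c', agree b c c')})
    (hVd : Vd = Nat.card {b : B // ∀ c c', agree b c c'})
    (hF : F = ∑ c : Fin 3, Nat.card (MulAction.orbitRel.Quotient
        (Subgroup.closure {ε, π c} : Subgroup (Equiv.Perm H)) H)) :
    2 * F ≤ 6 + 3 * Vt + 4 * Vp + 6 * Vd := by
  have hcard := card_vertex_types agree (fun b c => (hagree b c c).2 fun _ _ => rfl)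
    (fun b c c' h => (hagree b c' c).2 fun x hx => ((hagree b c c').1 h x hx).symm)
    (fun b c c' c'' h h' => (hagree b c c'').2 fun x hx =>
      ((hagree b c c').1 h x hx).trans ((hagree b c' c'').1 h' x hx))
  have hpair := card_faces_pair_le hblk hε hε' hπinv hπfpf hπblk hconn
  simp only [← hagree] at hpair
  have h01 := hpair 0 1
  have h02 := hpair 0 2
  have h12 := hpair 1 2
  rw [Fin.sum_univ_three] at hF
  omega
end

section
/- Let n ≥ 1 be an integer, let a > 0 be a real number, and let f : ℝ → [0, ∞] be a measurable function. Then, with equality in [0, ∞], ∫_{(0,∞)^n} f(β_1 + ⋯ + β_n) · Π_{i=1}^{n} β_i^{a−1} dβ = (Γ(a)^n / Γ(n·a)) · ∫_0^∞ f(x) · x^{n·a−1} dx, where the integrals are taken with respect to Lebesgue measure and Γ denotes the real Gamma function. -/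
open MeasureTheory

/-- The power `x ↦ x ^ (s - 1)` on `(0, ∞)`, extended by zero to the real line. -/
noncomputable def posPower (s : ℝ) : ℝ → ENNReal :=
  (Set.Ioi 0).indicator fun x => ENNReal.ofReal (x ^ (s - 1))

@[fun_prop]
lemma measurable_posPower (s : ℝ) : Measurable (posPower s) := by
  unfold posPower
  exact Measurable.indicator (by fun_prop) measurableSet_Ioi

lemma posPower_of_pos (s : ℝ) {x : ℝ} (hx : 0 < x) :
    posPower s x = ENNReal.ofReal (x ^ (s - 1)) :=
  Set.indicator_of_mem (Set.mem_Ioi.2 hx) _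

lemma posPower_of_nonpos (s : ℝ) {x : ℝ} (hx : x ≤ 0) : posPower s x = 0 :=
  Set.indicator_of_notMem (by simpa using hx) _

lemma posPower_mul (s : ℝ) {z : ℝ} (hz : 0 < z) (x : ℝ) :
    posPower s (z * x) = posPower s z * posPower s x := by
  rcases le_or_gt x 0 with hx | hx
  · rw [posPower_of_nonpos s hx, mul_zero,
      posPower_of_nonpos s (mul_nonpos_of_nonneg_of_nonpos hz.le hx)]
  · rw [posPower_of_pos s (mul_pos hz hx), posPower_of_pos s hz, posPower_of_pos s hx,
      Real.mul_rpow hz.le hx.le, ENNReal.ofReal_mul (by positivity)]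

lemma lintegral_posPower_mul_posPower_one_sub {s t : ℝ} (hs : 0 < s) (ht : 0 < t) :
    ∫⁻ u, posPower s u * posPower t (1 - u) = ENNReal.ofReal (ProbabilityTheory.beta s t) := by
  have hB := ProbabilityTheory.beta_pos hs ht
  have h (u : ℝ) : posPower s u * posPower t (1 - u) =
      ENNReal.ofReal (ProbabilityTheory.beta s t) * ProbabilityTheory.betaPDF s t u := by
    rcases le_or_gt u 0 with hu | hu
    · rw [posPower_of_nonpos s hu, ProbabilityTheory.betaPDF_eq_zero_of_nonpos hu, zero_mul,
        mul_zero]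
    rcases le_or_gt 1 u with hu' | hu'
    · rw [posPower_of_nonpos t (sub_nonpos.2 hu'),
        ProbabilityTheory.betaPDF_eq_zero_of_one_le hu', mul_zero, mul_zero]
    · rw [posPower_of_pos s hu, posPower_of_pos t (sub_pos.2 hu'),
        ProbabilityTheory.betaPDF_of_pos_lt_one hu hu', ← ENNReal.ofReal_mul (by positivity),
        ← ENNReal.ofReal_mul hB.le]
      congr 1
      field_simp
  simp_rw [h]
  rw [lintegral_const_mul' _ _ ENNReal.ofReal_ne_top,
    ProbabilityTheory.lintegral_betaPDF_eq_one hs ht, mul_one]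

lemma lintegral_eq_ofReal_mul_lintegral_comp_mul_left {z : ℝ} (hz : 0 < z) {g : ℝ → ENNReal}
    (hg : Measurable g) : ∫⁻ x, g x = ENNReal.ofReal z * ∫⁻ u, g (z * u) := by
  conv_lhs => rw [← Real.smul_map_volume_mul_left hz.ne']
  rw [lintegral_smul_measure, lintegral_map hg (by fun_prop), abs_of_pos hz, smul_eq_mul]

lemma lintegral_posPower_mul_posPower_sub {s t : ℝ} (hs : 0 < s) (ht : 0 < t) (z : ℝ) :
    ∫⁻ x, posPower s x * posPower t (z - x) =
      ENNReal.ofReal (ProbabilityTheory.beta s t) * posPower (s + t) z := by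
  rcases le_or_gt z 0 with hz | hz
  · rw [posPower_of_nonpos _ hz, mul_zero, ← lintegral_zero (μ := (volume : Measure ℝ))]
    congr 1 with x
    rcases le_or_gt x 0 with hx | hx
    · rw [posPower_of_nonpos s hx, zero_mul]
    · rw [posPower_of_nonpos t (by linarith), mul_zero]
  · rw [lintegral_eq_ofReal_mul_lintegral_comp_mul_left hz (by fun_prop)]
    have h (u : ℝ) : posPower s (z * u) * posPower t (z - z * u) =
        posPower s z * posPower t z * (posPower s u * posPower t (1 - u)) := by
      rw [← mul_one_sub, posPower_mul s hz, posPower_mul t hz]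
      ring
    simp_rw [h]
    rw [lintegral_const_mul _ (by fun_prop), lintegral_posPower_mul_posPower_one_sub hs ht,
      ← mul_assoc, mul_comm]
    congr 1
    rw [posPower_of_pos s hz, posPower_of_pos t hz, posPower_of_pos _ hz,
      ← ENNReal.ofReal_mul (by positivity), ← ENNReal.ofReal_mul hz.le, ← Real.rpow_add hz]
    nth_rw 1 [← Real.rpow_one z]
    rw [← Real.rpow_add hz]
    congr 2
    ring

lemma lintegral_posPower_mul_lintegral_comp_add {s t : ℝ} (hs : 0 < s) (ht : 0 < t)
    {f : ℝ → ENNReal} (hf : Measurable f) :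
    ∫⁻ x, posPower s x * ∫⁻ y, f (x + y) * posPower t y =
      ENNReal.ofReal (ProbabilityTheory.beta s t) * ∫⁻ z, f z * posPower (s + t) z := by
  have h (x : ℝ) : posPower s x * ∫⁻ y, f (x + y) * posPower t y =
      ∫⁻ z, f z * (posPower s x * posPower t (z - x)) := by
    rw [← lintegral_add_left_eq_self (fun z => f z * (posPower s x * posPower t (z - x))) x,
      ← lintegral_const_mul _ (by fun_prop)]
    congr 1 with y
    rw [add_sub_cancel_left]
    ring
  simp_rw [h]
  rw [lintegral_lintegral_swap (by fun_prop), ← lintegral_const_mul _ (by fun_prop)]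
  congr 1 with z
  rw [lintegral_const_mul _ (by fun_prop), lintegral_posPower_mul_posPower_sub hs ht]
  ring

lemma lintegral_comp_sum_mul_prod_posPower (n : ℕ) {a : ℝ} (ha : 0 < a)
    {f : ℝ → ENNReal} (hf : Measurable f) :
    ∫⁻ β : Fin (n + 1) → ℝ, f (∑ i, β i) * ∏ i, posPower a (β i) =
      ENNReal.ofReal (Real.Gamma a ^ (n + 1) / Real.Gamma ((n + 1 : ℕ) * a)) *
        ∫⁻ x, f x * posPower ((n + 1 : ℕ) * a) x := by
  induction n generalizing f with
  | zero =>
    have hΓ := (Real.Gamma_pos_of_pos ha).ne'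
    refine ((volume_preserving_funUnique (Fin 1) ℝ).symm.lintegral_comp
      (f := fun β => f (∑ i, β i) * ∏ i, posPower a (β i)) (by fun_prop)).symm.trans ?_
    simp [hΓ]
  | succ n ih =>
    have hna : 0 < ((n + 1 : ℕ) : ℝ) * a := by positivity
    rw [← (volume_preserving_piFinSuccAbove (fun _ : Fin (n + 2) => ℝ) 0).symm.lintegral_comp
      (by fun_prop), Measure.volume_eq_prod, lintegral_prod _ (by fun_prop)]
    have h (x : ℝ) : ∫⁻ β : Fin (n + 1) → ℝ,
        f (x + ∑ i, β i) * (posPower a x * ∏ i, posPower a (β i)) =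
        ENNReal.ofReal (Real.Gamma a ^ (n + 1) / Real.Gamma ((n + 1 : ℕ) * a)) *
          (posPower a x * ∫⁻ y, f (x + y) * posPower ((n + 1 : ℕ) * a) y) := by
      rw [mul_left_comm, ← ih (f := fun y => f (x + y)) (by fun_prop),
        ← lintegral_const_mul _ (by fun_prop)]
      congr 1 with β
      ring
    simp only [MeasurableEquiv.piFinSuccAbove_symm_apply, Fin.insertNthEquiv_zero,
      Fin.consEquiv_apply, Fin.sum_univ_succ (n := n + 1), Fin.prod_univ_succ (n := n + 1),
      Fin.cons_zero, Fin.cons_succ]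
    simp_rw [h]
    rw [lintegral_const_mul' _ _ ENNReal.ofReal_ne_top,
      lintegral_posPower_mul_lintegral_comp_add ha hna hf, ← mul_assoc,
      ← ENNReal.ofReal_mul (by have := Real.Gamma_pos_of_pos ha
                               have := Real.Gamma_pos_of_pos hna
                               positivity)]
    have hsum : a + ((n + 1 : ℕ) : ℝ) * a = ((n + 1 + 1 : ℕ) : ℝ) * a := by push_cast; ring
    have hΓ := (Real.Gamma_pos_of_pos hna).ne'
    rw [ProbabilityTheory.beta, hsum]
    congr 2
    field_simp
    ring

/-- **Dirichlet-type reduction of an orthant integral.**  For `n ≥ 1`, `a > 0` and any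
measurable `f : ℝ → [0,∞]`, one has (with equality in `[0,∞]`)
`∫_{(0,∞)ⁿ} f(β₁+⋯+βₙ)·Π βᵢ^{a-1} dβ = (Γ(a)ⁿ/Γ(na))·∫₀^∞ f(x)·x^{na-1} dx`. -/
theorem orthant_dirichlet_integral
    (n : ℕ) (hn : 1 ≤ n) (a : ℝ) (ha : 0 < a)
    (f : ℝ → ENNReal) (hf : Measurable f) :
    (∫⁻ β in Set.univ.pi (fun _ : Fin n => Set.Ioi (0 : ℝ)),
        f (∑ i, β i) * ∏ i, ENNReal.ofReal (β i ^ (a - 1)))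
      = ENNReal.ofReal (Real.Gamma a ^ n / Real.Gamma (n * a)) *
        ∫⁻ x in Set.Ioi (0 : ℝ), f x * ENNReal.ofReal (x ^ ((n : ℝ) * a - 1)) := by
  obtain ⟨n, rfl⟩ := Nat.exists_eq_add_of_le' hn
  rw [← lintegral_indicator (MeasurableSet.univ_pi fun _ => measurableSet_Ioi),
    ← lintegral_indicator measurableSet_Ioi]
  have h_left (β : Fin (n + 1) → ℝ) : (Set.univ.pi fun _ => Set.Ioi 0).indicator
      (fun β => f (∑ i, β i) * ∏ i, ENNReal.ofReal (β i ^ (a - 1))) β =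
        f (∑ i, β i) * ∏ i, posPower a (β i) := by
    by_cases h : ∀ i, 0 < β i
    · rw [Set.indicator_of_mem (by simpa using h)]
      simp_rw [fun i => posPower_of_pos a (h i)]
    · rw [Set.indicator_of_notMem (by simpa using h)]
      obtain ⟨i, hi⟩ := not_forall.1 h
      rw [Finset.prod_eq_zero (Finset.mem_univ i) (posPower_of_nonpos a (not_lt.1 hi)), mul_zero]
  simp_rw [h_left, Set.indicator_mul_right]
  exact lintegral_comp_sum_mul_prod_posPower n ha hf
end

section
/- Let q ≥ 3 be an integer and let d be a real number with 0 < d < 2q/(q−2), and set ζ := d/2 − d/q (so that 0 < ζ < 1 and d/2 − ζ = d/q > 0). Then ∫_0^1 ∫_{(0,∞)^{q−1}} [ (Π_{i=1}^{q−1} α_i^ζ) / (Σ_{i=1}^{q−1} Π_{j≠i} α_j)^{d/2+1} ] · exp( −t · (Π_{i=1}^{q−1} α_i) / (Σ_{i=1}^{q−1} Π_{j≠i} α_j) ) dα dt = Γ(1−ζ) · Γ(d/2 − ζ)^{q−1} / ( ζ · Γ(d/2 + ζ) ), where the inner integral is over the positive orthant (0,∞)^{q−1} with Lebesgue measure and Γ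 denotes the real Gamma function. -/
open MeasureTheory

open Set Real in
theorem lintegral_Ioi_comp_const_div {c : ℝ} (hc : 0 < c) (g : ℝ → ENNReal) :
    ∫⁻ x in Ioi (0 : ℝ), g x
      = ∫⁻ x in Ioi (0 : ℝ), ENNReal.ofReal (c / x ^ 2) * g (c / x) := by
  have himg : (fun x : ℝ => c / x) '' Ioi 0 = Ioi 0 := by
    ext y
    constructor
    · rintro ⟨x, hx, rfl⟩
      exact div_pos hc hx
    · intro hy
      refine ⟨c / y, div_pos hc hy, ?_⟩
      have hy' : y ≠ 0 := ne_of_gt hy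
      field_simp
  have hderiv : ∀ x ∈ Ioi (0 : ℝ),
      HasDerivWithinAt (fun x : ℝ => c / x) (-(c / x ^ 2)) (Ioi 0) x := by
    intro x hx
    have h := (hasDerivAt_inv (ne_of_gt hx)).const_mul c
    refine (h.congr_deriv ?_).hasDerivWithinAt
    ring
  have hinj : InjOn (fun x : ℝ => c / x) (Ioi 0) := by
    intro x hx y hy hxy
    have hx' : x ≠ 0 := ne_of_gt hx
    have hy' : y ≠ 0 := ne_of_gt hy
    simp only [div_eq_mul_inv] at hxy
    exact inv_injective (mul_left_cancel₀ hc.ne' hxy)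
  have h := lintegral_image_eq_lintegral_abs_deriv_mul measurableSet_Ioi hderiv hinj g
  rw [himg] at h
  rw [h]
  refine setLIntegral_congr_fun measurableSet_Ioi fun x _ => ?_
  simp only [abs_neg]
  rw [abs_of_nonneg (by positivity)]

open Set in
theorem lintegral_orthant_comp_smul {ι : Type*} [Fintype ι] {r : ℝ} (hr : 0 < r)
    (g : (ι → ℝ) → ENNReal) :
    ∫⁻ x in univ.pi (fun _ : ι => Ioi (0 : ℝ)), g x
      = ∫⁻ x in univ.pi (fun _ : ι => Ioi (0 : ℝ)),
          ENNReal.ofReal (r ^ Fintype.card ι) * g (r • x) := by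
  have himg : (fun x : ι → ℝ => r • x) '' univ.pi (fun _ : ι => Ioi (0 : ℝ))
      = univ.pi (fun _ : ι => Ioi (0 : ℝ)) := by
    ext y
    constructor
    · rintro ⟨x, hx, rfl⟩ i hi
      exact mul_pos hr (hx i hi)
    · intro hy
      refine ⟨r⁻¹ • y, fun i hi => mul_pos (inv_pos.2 hr) (hy i hi), ?_⟩
      simp [smul_smul, hr.ne']
  have hderiv : ∀ x ∈ univ.pi (fun _ : ι => Ioi (0 : ℝ)),
      HasFDerivWithinAt (fun x : ι → ℝ => r • x) (r • ContinuousLinearMap.id ℝ (ι → ℝ))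
        (univ.pi (fun _ : ι => Ioi (0 : ℝ))) x :=
    fun x _ => ((hasFDerivAt_id x).const_smul r).hasFDerivWithinAt
  have h := lintegral_image_eq_lintegral_abs_det_fderiv_mul volume
    (MeasurableSet.univ_pi fun _ : ι => measurableSet_Ioi) hderiv
    (smul_right_injective _ hr.ne').injOn g
  rw [himg] at h
  have hdet : (r • ContinuousLinearMap.id ℝ (ι → ℝ)).det = r ^ Fintype.card ι := by
    simp [ContinuousLinearMap.det]
  rw [h]
  simp only [hdet, abs_of_pos (pow_pos hr (Fintype.card ι))]

open Set Real in
theorem lintegral_rpow_mul_exp_neg_mul_Ioi {a r : ℝ} (ha : 0 < a) (hr : 0 < r) :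
    ∫⁻ x in Ioi (0 : ℝ), ENNReal.ofReal (x ^ (a - 1) * exp (-(r * x)))
      = ENNReal.ofReal ((1 / r) ^ a * Gamma a) := by
  rw [← integral_rpow_mul_exp_neg_mul_Ioi ha hr]
  refine (ofReal_integral_eq_lintegral_ofReal ?_ ?_).symm
  · have h := integrableOn_rpow_mul_exp_neg_mul_rpow (s := a - 1) (p := 1) (b := r)
      (by linarith) one_pos hr
    simpa [IntegrableOn] using h
  · filter_upwards [ae_restrict_mem measurableSet_Ioi] with x hx
    have hx' : (0 : ℝ) < x := hx
    positivity

open Set Real in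
theorem lintegral_rpow_mul_exp_neg_div_Ioi {a r : ℝ} (ha : 0 < a) (hr : 0 < r) :
    ∫⁻ x in Ioi (0 : ℝ), ENNReal.ofReal (x ^ (-a - 1) * exp (-(r / x)))
      = ENNReal.ofReal ((1 / r) ^ a * Gamma a) := by
  rw [← lintegral_rpow_mul_exp_neg_mul_Ioi ha hr, lintegral_Ioi_comp_const_div one_pos
    (fun x => ENNReal.ofReal (x ^ (a - 1) * exp (-(r * x))))]
  refine setLIntegral_congr_fun measurableSet_Ioi fun x hx => ?_
  have hx' : (0 : ℝ) < x := hx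
  rw [← ENNReal.ofReal_mul (by positivity)]
  congr 1
  have h1 : x ^ (-a - 1) = (1 / x) ^ (a - 1) * (1 / x ^ 2) := by
    rw [one_div, inv_rpow hx'.le, ← rpow_neg hx'.le, one_div, ← rpow_natCast, ← rpow_neg hx'.le,
      ← rpow_add hx']
    congr 1
    push_cast
    ring
  rw [h1, show r * (1 / x) = r / x by ring]
  ring

open Set Real in
theorem lintegral_orthant_prod_rpow_mul_exp_neg_sum_inv {ι : Type*} [Fintype ι] {a : ℝ}
    (ha : 0 < a) :
    ∫⁻ x in univ.pi (fun _ : ι => Ioi (0 : ℝ)),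
        ENNReal.ofReal ((∏ i, (x i) ^ (-a - 1)) * exp (-(∑ i, (x i)⁻¹)))
      = ENNReal.ofReal (Gamma a ^ Fintype.card ι) := by
  set h : ℝ → ℝ := fun x => x ^ (-a - 1) * exp (-(1 / x)) with hh
  have hnn : ∀ x ∈ Ioi (0 : ℝ), 0 ≤ h x := fun x hx => by
    have hx' : (0 : ℝ) < x := hx
    positivity
  have hval : ∫⁻ x in Ioi (0 : ℝ), ENNReal.ofReal (h x) = ENNReal.ofReal (Gamma a) := by
    simpa [hh] using lintegral_rpow_mul_exp_neg_div_Ioi ha one_pos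
  have hnn_ae : 0 ≤ᵐ[volume.restrict (Ioi (0 : ℝ))] h :=
    (ae_restrict_mem measurableSet_Ioi).mono hnn
  have hmeas : Measurable h := by fun_prop
  have hint : Integrable h (volume.restrict (Ioi (0 : ℝ))) := by
    refine ⟨hmeas.aestronglyMeasurable, ?_⟩
    rw [hasFiniteIntegral_iff_ofReal hnn_ae, hval]
    exact ENNReal.ofReal_lt_top
  have hintval : ∫ x in Ioi (0 : ℝ), h x = Gamma a := by
    rw [integral_eq_lintegral_of_nonneg_ae hnn_ae hmeas.aestronglyMeasurable, hval,
      ENNReal.toReal_ofReal (Gamma_pos_of_pos ha).le]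
  have hpi : (volume : Measure (ι → ℝ)).restrict (univ.pi fun _ => Ioi 0)
      = Measure.pi fun _ => volume.restrict (Ioi 0) := by
    rw [volume_pi, Measure.restrict_pi_pi]
  have hprod : ∀ x : ι → ℝ,
      (∏ i, (x i) ^ (-a - 1)) * exp (-(∑ i, (x i)⁻¹)) = ∏ i, h (x i) := by
    intro x
    simp only [hh, Finset.prod_mul_distrib, one_div, ← exp_sum, Finset.sum_neg_distrib]
  simp only [hprod]
  rw [← hintval, ← integral_fintype_prod_eq_pow, ← hpi]
  refine (ofReal_integral_eq_lintegral_ofReal ?_ ?_).symm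
  · rw [hpi]
    exact Integrable.fintype_prod fun _ => hint
  · filter_upwards [ae_restrict_mem (MeasurableSet.univ_pi fun _ : ι => measurableSet_Ioi)]
      with x hx
    exact Finset.prod_nonneg fun i _ => hnn _ (hx i (mem_univ i))

open Set Real in
/-- The pushforward of `∏ i, x i ^ (-a - 1)` on the positive orthant under `x ↦ ∑ i, (x i)⁻¹`:
the Dirichlet integral in inverted coordinates. -/
theorem lintegral_orthant_prod_rpow_mul_comp_sum_inv {ι : Type*} [Fintype ι] [Nonempty ι] {a : ℝ}
    (ha : 0 < a) {f : ℝ → ENNReal} (hf : Measurable f) :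
    ENNReal.ofReal (Gamma (Fintype.card ι * a)) *
      ∫⁻ x in univ.pi (fun _ : ι => Ioi (0 : ℝ)),
        ENNReal.ofReal (∏ i, (x i) ^ (-a - 1)) * f (∑ i, (x i)⁻¹)
      = ENNReal.ofReal (Gamma a ^ Fintype.card ι) *
          ∫⁻ s in Ioi (0 : ℝ), ENNReal.ofReal (s ^ (Fintype.card ι * a - 1)) * f s := by
  set m : ℝ := Fintype.card ι * a with hm
  have hm0 : 0 < m := by positivity
  set W : (ι → ℝ) → ℝ := fun x => ∏ i, (x i) ^ (-a - 1) with hW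
  set S : (ι → ℝ) → ℝ := fun x => ∑ i, (x i)⁻¹ with hS
  set O : Set (ι → ℝ) := univ.pi (fun _ : ι => Ioi (0 : ℝ)) with hO
  have hOm : MeasurableSet O := MeasurableSet.univ_pi fun _ : ι => measurableSet_Ioi
  have hWm : Measurable W := by fun_prop
  have hSm : Measurable S := by fun_prop
  have hW0 : ∀ x ∈ O, 0 < W x := fun x hx =>
    Finset.prod_pos fun i _ => rpow_pos_of_pos (hx i (mem_univ i)) _
  have hS0 : ∀ x ∈ O, 0 < S x := fun x hx =>
    Finset.sum_pos (fun i _ => inv_pos.2 (hx i (mem_univ i))) Finset.univ_nonempty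
  have hSr : ∀ (r : ℝ) (x : ι → ℝ), S (r • x) = S x / r := fun r x => by
    simp only [hS, Pi.smul_apply, smul_eq_mul, mul_inv, ← Finset.mul_sum]
    ring
  have hWr : ∀ r : ℝ, 0 < r → ∀ x ∈ O,
      r ^ Fintype.card ι * W (r • x) = r ^ (-m) * W x := fun r hr x hx => by
    have h1 : ∀ i, (r • x) i ^ (-a - 1) = r ^ (-a - 1) * (x i) ^ (-a - 1) := fun i =>
      mul_rpow hr.le (le_of_lt (hx i (mem_univ i)))
    simp only [hW, h1, Finset.prod_mul_distrib, Finset.prod_const, Finset.card_univ]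
    rw [← mul_assoc, ← mul_pow, ← rpow_one_add' hr.le (by linarith), ← rpow_mul_natCast hr.le]
    congr 2
    rw [hm]
    ring
  calc ENNReal.ofReal (Gamma m) * ∫⁻ x in O, ENNReal.ofReal (W x) * f (S x)
      = ∫⁻ x in O, ∫⁻ r in Ioi (0 : ℝ),
          ENNReal.ofReal (S x ^ m * W x * (r ^ (m - 1) * exp (-(S x * r)))) * f (S x) := by
        rw [← lintegral_const_mul _ (by fun_prop)]
        refine setLIntegral_congr_fun hOm fun x hx => ?_
        have hSx := hS0 x hx
        have hWx := hW0 x hx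
        have h1 : ∀ r : ℝ,
            ENNReal.ofReal (S x ^ m * W x * (r ^ (m - 1) * exp (-(S x * r)))) * f (S x)
              = ENNReal.ofReal (S x ^ m * W x) * f (S x) *
                ENNReal.ofReal (r ^ (m - 1) * exp (-(S x * r))) := fun r => by
          rw [ENNReal.ofReal_mul (by positivity)]
          ring
        simp only [h1]
        rw [lintegral_const_mul _ (by fun_prop), lintegral_rpow_mul_exp_neg_mul_Ioi hm0 hSx,
          mul_right_comm (ENNReal.ofReal _), ← ENNReal.ofReal_mul (by positivity), ← mul_assoc,
          ← ENNReal.ofReal_mul (Gamma_pos_of_pos hm0).le, one_div, inv_rpow hSx.le]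
        congr 2
        have : S x ^ m ≠ 0 := (rpow_pos_of_pos hSx m).ne'
        field_simp
    _ = ∫⁻ r in Ioi (0 : ℝ), ∫⁻ x in O,
          ENNReal.ofReal (S x ^ m * W x * (r ^ (m - 1) * exp (-(S x * r)))) * f (S x) :=
        lintegral_lintegral_swap (Measurable.aemeasurable (by fun_prop))
    _ = ∫⁻ r in Ioi (0 : ℝ), ∫⁻ x in O,
          ENNReal.ofReal (W x * exp (-S x)) *
            (ENNReal.ofReal (S x ^ m * r ^ (-m - 1)) * f (S x / r)) := by
        refine setLIntegral_congr_fun measurableSet_Ioi fun r hr => ?_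
        have hr' : (0 : ℝ) < r := hr
        rw [lintegral_orthant_comp_smul hr']
        refine setLIntegral_congr_fun hOm fun x hx => ?_
        have hSx := hS0 x hx
        have hWx := hW0 x hx
        rw [hSr, ← mul_assoc (ENNReal.ofReal (r ^ _)), ← ENNReal.ofReal_mul (by positivity),
          ← mul_assoc (ENNReal.ofReal (W x * _)), ← ENNReal.ofReal_mul (by positivity)]
        congr 2
        have h2 : r ^ (-m - 1) = r ^ (-m) * (r ^ m)⁻¹ * r ^ (m - 1) := by
          rw [← rpow_neg hr'.le, ← rpow_add hr', ← rpow_add hr']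
          congr 1
          ring
        rw [div_rpow hSx.le hr'.le, div_mul_cancel₀ _ hr'.ne', h2]
        linear_combination (S x ^ m / r ^ m * r ^ (m - 1) * exp (-S x)) * hWr r hr' x hx
    _ = ∫⁻ x in O, ∫⁻ r in Ioi (0 : ℝ),
          ENNReal.ofReal (W x * exp (-S x)) *
            (ENNReal.ofReal (S x ^ m * r ^ (-m - 1)) * f (S x / r)) :=
        lintegral_lintegral_swap (Measurable.aemeasurable (by fun_prop))
    _ = ∫⁻ x in O, ENNReal.ofReal (W x * exp (-S x)) *
          ∫⁻ s in Ioi (0 : ℝ), ENNReal.ofReal (s ^ (m - 1)) * f s := by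
        refine setLIntegral_congr_fun hOm fun x hx => ?_
        have hSx := hS0 x hx
        rw [lintegral_const_mul _ (by fun_prop), lintegral_Ioi_comp_const_div hSx
          (fun s => ENNReal.ofReal (s ^ (m - 1)) * f s)]
        congr 1
        refine setLIntegral_congr_fun measurableSet_Ioi fun r hr => ?_
        have hr' : (0 : ℝ) < r := hr
        rw [← mul_assoc, ← ENNReal.ofReal_mul (by positivity)]
        congr 2
        have h2 : r ^ (-m - 1) = (r ^ (m - 1))⁻¹ * (r ^ 2)⁻¹ := by
          rw [← rpow_neg hr'.le, ← rpow_natCast, ← rpow_neg hr'.le, ← rpow_add hr']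
          congr 1
          push_cast
          ring
        have h3 : S x ^ m = S x ^ (m - 1) * S x := by
          rw [← rpow_add_one hSx.ne']
          congr 1
          ring
        rw [div_rpow hSx.le hr'.le, h2, h3]
        ring
    _ = ENNReal.ofReal (Gamma a ^ Fintype.card ι) *
          ∫⁻ s in Ioi (0 : ℝ), ENNReal.ofReal (s ^ (m - 1)) * f s := by
        rw [lintegral_mul_const _ (by fun_prop)]
        congr 1
        exact lintegral_orthant_prod_rpow_mul_exp_neg_sum_inv ha

open Set Real in
theorem lintegral_Ioc_rpow_sub_one {b : ℝ} (hb : 0 < b) :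
    ∫⁻ t in Ioc (0 : ℝ) 1, ENNReal.ofReal (t ^ (b - 1)) = ENNReal.ofReal (1 / b) := by
  have hint : IntervalIntegrable (fun t : ℝ => t ^ (b - 1)) volume 0 1 :=
    intervalIntegral.intervalIntegrable_rpow' (by linarith)
  rw [← ofReal_integral_eq_lintegral_ofReal
      ((intervalIntegrable_iff_integrableOn_Ioc_of_le zero_le_one).1 hint),
    ← intervalIntegral.integral_of_le zero_le_one, integral_rpow (Or.inl (by linarith))]
  · simp [hb.ne']
  · filter_upwards [ae_restrict_mem measurableSet_Ioc] with t ht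
    exact rpow_nonneg ht.1.le _

/-- **The wave-function renormalization integral.**  For an integer `q ≥ 3` and a real
`0 < d < 2q/(q-2)`, with `ζ = d/2 - d/q`, one has
`∫₀¹ dt ∫_{(0,∞)^{q-1}} (Π αᵢ^ζ)/(Σᵢ Π_{j≠i} αⱼ)^{d/2+1} ·
  exp(−t·(Π αᵢ)/(Σᵢ Π_{j≠i} αⱼ)) dα = Γ(1−ζ)·Γ(d/2−ζ)^{q−1}/(ζ·Γ(d/2+ζ))`. -/
theorem wave_function_integral
    (q : ℕ) (hq : 3 ≤ q) (d : ℝ) (hd0 : 0 < d) (hd : d < 2 * q / (q - 2))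
    (ζ : ℝ) (hζ : ζ = d / 2 - d / q) :
    (∫⁻ t in Set.Ioc (0 : ℝ) 1,
      ∫⁻ α in Set.univ.pi (fun _ : Fin (q - 1) => Set.Ioi (0 : ℝ)),
        ENNReal.ofReal
          ((∏ i, α i ^ ζ) /
              (∑ i, ∏ j ∈ Finset.univ.erase i, α j) ^ (d / 2 + 1) *
            Real.exp (-t * (∏ i, α i) / (∑ i, ∏ j ∈ Finset.univ.erase i, α j))))
      = ENNReal.ofReal
          (Real.Gamma (1 - ζ) * Real.Gamma (d / 2 - ζ) ^ (q - 1) /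
            (ζ * Real.Gamma (d / 2 + ζ))) := by
  have hq3 : (3 : ℝ) ≤ q := by exact_mod_cast hq
  have hq0 : (0 : ℝ) < q := by linarith
  have hζ' : ζ = d * (q - 2) / (2 * q) := by
    rw [hζ]
    field_simp
  have hζ0 : 0 < ζ := by
    rw [hζ']
    exact div_pos (mul_pos hd0 (by linarith)) (by linarith)
  have hζ1 : ζ < 1 := by
    rw [lt_div_iff₀ (by linarith)] at hd
    rw [hζ', div_lt_one (by linarith)]
    exact hd
  have ha : 0 < d / 2 - ζ := by
    rw [hζ, sub_sub_cancel]
    positivity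
  have : Nonempty (Fin (q - 1)) := ⟨⟨0, by omega⟩⟩
  have hm : (Fintype.card (Fin (q - 1)) : ℝ) * (d / 2 - ζ) = d / 2 + ζ := by
    rw [Fintype.card_fin, Nat.cast_sub (by omega), hζ]
    push_cast
    field_simp
    ring
  have hΓ : 0 < Real.Gamma (d / 2 + ζ) := Real.Gamma_pos_of_pos (by linarith)
  have hΓ' : 0 < Real.Gamma (1 - ζ) := Real.Gamma_pos_of_pos (by linarith)
  have hinner : ∀ t ∈ Set.Ioc (0 : ℝ) 1,
      (∫⁻ α in Set.univ.pi (fun _ : Fin (q - 1) => Set.Ioi (0 : ℝ)),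
        ENNReal.ofReal
          ((∏ i, α i ^ ζ) /
              (∑ i, ∏ j ∈ Finset.univ.erase i, α j) ^ (d / 2 + 1) *
            Real.exp (-t * (∏ i, α i) / (∑ i, ∏ j ∈ Finset.univ.erase i, α j))))
      = ENNReal.ofReal (Real.Gamma (1 - ζ) * Real.Gamma (d / 2 - ζ) ^ (q - 1) /
          Real.Gamma (d / 2 + ζ)) * ENNReal.ofReal (t ^ (ζ - 1)) := by
    intro t ht
    have hD := lintegral_orthant_prod_rpow_mul_comp_sum_inv (ι := Fin (q - 1)) ha
      (f := fun s => ENNReal.ofReal (s ^ (-(d / 2 + 1)) * Real.exp (-(t / s)))) (by fun_prop)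
    have hradial : ∫⁻ s in Set.Ioi (0 : ℝ), ENNReal.ofReal (s ^ (d / 2 + ζ - 1)) *
          ENNReal.ofReal (s ^ (-(d / 2 + 1)) * Real.exp (-(t / s)))
        = ENNReal.ofReal (t ^ (ζ - 1) * Real.Gamma (1 - ζ)) := by
      have h1 : t ^ (ζ - 1) = (1 / t) ^ (1 - ζ) := by
        rw [one_div, Real.inv_rpow ht.1.le, ← Real.rpow_neg ht.1.le, neg_sub]
      rw [h1, ← lintegral_rpow_mul_exp_neg_div_Ioi (by linarith) ht.1]
      refine setLIntegral_congr_fun measurableSet_Ioi fun s hs => ?_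
      have hs' : (0 : ℝ) < s := hs
      rw [← ENNReal.ofReal_mul (by positivity), ← mul_assoc, ← Real.rpow_add hs']
      congr 3
      ring
    rw [hm, hradial, Fintype.card_fin] at hD
    have hcongr : ∀ α ∈ Set.univ.pi (fun _ : Fin (q - 1) => Set.Ioi (0 : ℝ)),
        ENNReal.ofReal
          ((∏ i, α i ^ ζ) /
              (∑ i, ∏ j ∈ Finset.univ.erase i, α j) ^ (d / 2 + 1) *
            Real.exp (-t * (∏ i, α i) / (∑ i, ∏ j ∈ Finset.univ.erase i, α j)))
        = ENNReal.ofReal (∏ i, (α i) ^ (-(d / 2 - ζ) - 1)) *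
          ENNReal.ofReal ((∑ i, (α i)⁻¹) ^ (-(d / 2 + 1)) *
            Real.exp (-(t / ∑ i, (α i)⁻¹))) := by
      intro α hα
      have hα0 : ∀ i, 0 < α i := fun i => hα i (Set.mem_univ i)
      have hP : 0 < ∏ i, α i := Finset.prod_pos fun i _ => hα0 i
      have hS : 0 < ∑ i, (α i)⁻¹ :=
        Finset.sum_pos (fun i _ => inv_pos.2 (hα0 i)) Finset.univ_nonempty
      have hsum : ∑ i, ∏ j ∈ Finset.univ.erase i, α j = (∏ i, α i) * ∑ i, (α i)⁻¹ := by
        rw [Finset.mul_sum]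
        refine Finset.sum_congr rfl fun i _ => ?_
        rw [← Finset.mul_prod_erase _ _ (Finset.mem_univ i)]
        field_simp [(hα0 i).ne']
      have hexp : -t * (∏ i, α i) / ((∏ i, α i) * ∑ i, (α i)⁻¹) = -(t / ∑ i, (α i)⁻¹) := by
        field_simp
      rw [hsum, hexp, ← ENNReal.ofReal_mul (Finset.prod_nonneg fun i _ =>
        (Real.rpow_pos_of_pos (hα0 i) _).le), ← mul_assoc]
      congr 2
      rw [Real.finsetProd_rpow _ _ fun i _ => (hα0 i).le,
        Real.finsetProd_rpow _ _ fun i _ => (hα0 i).le, Real.mul_rpow hP.le hS.le,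
        Real.rpow_neg hS.le, show -(d / 2 - ζ) - 1 = ζ - (d / 2 + 1) by ring, Real.rpow_sub hP]
      field_simp
    rw [setLIntegral_congr_fun (MeasurableSet.univ_pi fun _ => measurableSet_Ioi) hcongr]
    have hc : ENNReal.ofReal (Real.Gamma (d / 2 + ζ)) ≠ 0 := by simpa using hΓ
    rw [← ENNReal.mul_right_inj hc ENNReal.ofReal_ne_top, hD,
      ← ENNReal.ofReal_mul (pow_nonneg (Real.Gamma_pos_of_pos ha).le _),
      ← mul_assoc (ENNReal.ofReal _) (ENNReal.ofReal _),
      ← ENNReal.ofReal_mul hΓ.le, ← ENNReal.ofReal_mul (by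
        have := Real.Gamma_pos_of_pos ha
        positivity)]
    congr 1
    field_simp
  rw [setLIntegral_congr_fun measurableSet_Ioc hinner, lintegral_const_mul _ (by fun_prop),
    lintegral_Ioc_rpow_sub_one hζ0, ← ENNReal.ofReal_mul (by
      have := Real.Gamma_pos_of_pos ha
      positivity)]
  congr 1
  field_simp
end

section
/- Let U, S, T : (0, ∞) → ℝ be differentiable functions with 1 + S(k) ≠ 0 for all k, let ℓ ∈ ℝ be a constant with 1 + ℓ·T(k) ≠ 0 for all k, and define the running coupling g₁(k) := −U(k) + ℓ·(1 + S(k))² / (1 + ℓ·T(k)). Then for every k > 0, k·g₁'(k) = β₀(k) − 2·β₁(k)·g₁(k) + β₂(k)·g₁(k)², where β₀(k) := −k·U'(k) + 2·U(k)·k·S'(k)/(1 + S(k)) − U(k)²·k·T'(k)/(1 + S(k))², β₁(k) := −k·S'(k)/(1 + S(k)) + U(k)·k·T'(k)/(1 + S(k))², and β₂(k) := −k·T'(k)/(1 + S(k))². That is, the beta function of g₁ is exactly quadratic in g₁, with coefficients independent of the bare coupling ℓ. -/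
/-- **The beta function of the pillow coupling is exactly quadratic.**  Let `U, S, T` be
differentiable functions of the scale `k ∈ (0,∞)` with `1 + S(k) ≠ 0`, let `ℓ` be a
constant (the rescaled bare coupling) with `1 + ℓ·T(k) ≠ 0`, and let
`g₁(k) = −U(k) + ℓ·(1+S(k))²/(1+ℓ·T(k))` be the running coupling.  Then
`k·g₁'(k) = β₀(k) − 2·β₁(k)·g₁(k) + β₂(k)·g₁(k)²` with
`β₀ = −k·U' + 2U·k·S'/(1+S) − U²·k·T'/(1+S)²`,
`β₁ = −k·S'/(1+S) + U·k·T'/(1+S)²` and `β₂ = −k·T'/(1+S)²`: the beta function is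
quadratic in `g₁`, with coefficients independent of the bare coupling `ℓ`. -/
theorem pillow_beta_function_quadratic
    (U S T : ℝ → ℝ) (ℓ : ℝ)
    (hU : ∀ k, 0 < k → DifferentiableAt ℝ U k)
    (hS : ∀ k, 0 < k → DifferentiableAt ℝ S k)
    (hT : ∀ k, 0 < k → DifferentiableAt ℝ T k)
    (hSne : ∀ k, 0 < k → 1 + S k ≠ 0)
    (hTne : ∀ k, 0 < k → 1 + ℓ * T k ≠ 0) :
    ∀ k, 0 < k →
      k * deriv (fun k => -U k + ℓ * (1 + S k) ^ 2 / (1 + ℓ * T k)) k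
        = (-(k * deriv U k) + 2 * U k * (k * deriv S k) / (1 + S k)
              - U k ^ 2 * (k * deriv T k) / (1 + S k) ^ 2)
          - 2 * (-(k * deriv S k) / (1 + S k)
              + U k * (k * deriv T k) / (1 + S k) ^ 2)
            * (-U k + ℓ * (1 + S k) ^ 2 / (1 + ℓ * T k))
          + (-(k * deriv T k) / (1 + S k) ^ 2)
            * (-U k + ℓ * (1 + S k) ^ 2 / (1 + ℓ * T k)) ^ 2 := by
  intro k hk
  have hA := hSne k hk
  have hB := hTne k hk
  have hderiv : HasDerivAt (fun k => -U k + ℓ * (1 + S k) ^ 2 / (1 + ℓ * T k))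
      (-deriv U k + (ℓ * (2 * (1 + S k) * deriv S k) * (1 + ℓ * T k)
        - ℓ * (1 + S k) ^ 2 * (ℓ * deriv T k)) / (1 + ℓ * T k) ^ 2) k := by
    have hnum : HasDerivAt (fun k => ℓ * (1 + S k) ^ 2)
        (ℓ * (2 * (1 + S k) * deriv S k)) k := by
      simpa using (((hS k hk).hasDerivAt.const_add 1).fun_pow 2).const_mul ℓ
    have hden : HasDerivAt (fun k => 1 + ℓ * T k) (ℓ * deriv T k) k :=
      ((hT k hk).hasDerivAt.const_mul ℓ).const_add 1
    exact (hU k hk).hasDerivAt.fun_neg.fun_add (hnum.fun_div hden hB)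
  rw [hderiv.deriv]
  field_simp
  ring
end
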